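/- arXiv:2310.03974 — 2 statements merged into one kernel-verified Lean document; each statement's English description precedes it below -/
import Mathlib

section
/- There exists an absolute constant K' > 0 such that for every finite set X, every nontrivial increasing family F ⊆ 2^X (i.e. ∅ ≠ F ≠ 2^X) with ℓ(F) ≥ 2, and every integer k ≥ ℓ(F), one has q_f(F) ≤ p_c^k(F) ≤ K' · q_f(F) · log ℓ(F). -/
open Finset
open scoped Classical

/-- A family of subsets of a finite ground set is increasing. -/
def Increasing {α : Type*} (F : Finset (Finset α)) : Prop :=
  ∀ A ∈ F, ∀ B : Finset α, A ⊆ B → B ∈ F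

/-- The product measure `μ_p` of a family of subsets:
`μ_p(F) = ∑_{S ∈ F} p^{|S|} (1-p)^{|X \ S|}`. -/
noncomputable def mu {α : Type*} [Fintype α] (p : ℝ) (F : Finset (Finset α)) : ℝ :=
  ∑ S ∈ F, p ^ S.card * (1 - p) ^ (Fintype.card α - S.card)

/-- The minimal elements of a family `F`. -/
def minimals {α : Type*} [DecidableEq α] (F : Finset (Finset α)) : Finset (Finset α) :=
  F.filter fun A => ∀ B ∈ F, B ⊆ A → B = A

/-- `ℓ(F)`: the maximum size of a minimal element of `F`. -/
def ell {α : Type*} [DecidableEq α] (F : Finset (Finset α)) : ℕ :=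
  (minimals F).sup Finset.card

/-- The colored measure `μ_p^k` on families of subsets of `X' = X × [k]`:
a set `S` with all first coordinates distinct gets weight `(p/k)^{|S|}(1-p)^{|X|-|S|}`,
other sets get weight `0`. -/
noncomputable def muk {α : Type*} [Fintype α] [DecidableEq α] (p : ℝ) (k : ℕ)
    (F' : Finset (Finset (α × Fin k))) : ℝ :=
  ∑ S ∈ F', if (S.image Prod.fst).card = S.card then
    (p / (k : ℝ)) ^ S.card * (1 - p) ^ (Fintype.card α - S.card) else 0

/-- `F^rb`: the increasing family on `X × [k]` generated by the rainbow edges of the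
minimal elements of `F`, i.e. all sets containing some `{(x₁,i₁),…,(x_t,i_t)}` with
`{x₁,…,x_t}` a minimal element of `F`, the `xⱼ` distinct and the colors `iⱼ` distinct. -/
noncomputable def rainbowFamily {α : Type*} [Fintype α] [DecidableEq α]
    (F : Finset (Finset α)) (k : ℕ) : Finset (Finset (α × Fin k)) :=
  Finset.univ.filter fun T => ∃ S ⊆ T, (S.image Prod.fst).card = S.card ∧
    (S.image Prod.snd).card = S.card ∧ S.image Prod.fst ∈ minimals F

/-- `F` is weakly `p`-small: there is `g : 2^X → ℝ≥0` with `∑_{S ⊆ T} g(S) ≥ 1` for every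
`T ∈ F` and `∑_S g(S) p^{|S|} ≤ 1/2`. -/
def WeaklySmall {α : Type*} [Fintype α] [DecidableEq α] (p : ℝ) (F : Finset (Finset α)) : Prop :=
  ∃ g : Finset α → ℝ, (∀ S, 0 ≤ g S) ∧ (∀ T ∈ F, 1 ≤ ∑ S ∈ T.powerset, g S) ∧
    ∑ S : Finset α, g S * p ^ S.card ≤ 1 / 2

/-- The fractional expectation-threshold `q_f(F) = max {p : F is weakly p-small}`. -/
noncomputable def qf {α : Type*} [Fintype α] [DecidableEq α] (F : Finset (Finset α)) : ℝ :=
  sSup {p : ℝ | WeaklySmall p F}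

/-- The expectation of `f W`, where `W` is a random subset of `A` containing each element
independently with probability `r`. -/
noncomputable def subsetExp {β : Type*} (A : Finset β) (r : ℝ) (f : Finset β → ℝ) : ℝ :=
  ∑ W ∈ A.powerset, r ^ W.card * (1 - r) ^ (A.card - W.card) * f W

section SubsetExp

variable {β : Type*}

lemma subsetExp_empty (r : ℝ) (f : Finset β → ℝ) : subsetExp ∅ r f = f ∅ := by
  simp [subsetExp]

lemma subsetExp_mono {A : Finset β} {r : ℝ} (h0 : 0 ≤ r) (h1 : r ≤ 1) {f g : Finset β → ℝ}
    (h : ∀ W ⊆ A, f W ≤ g W) : subsetExp A r f ≤ subsetExp A r g := by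
  refine sum_le_sum fun W hW => mul_le_mul_of_nonneg_left (h W (mem_powerset.1 hW)) ?_
  have : 0 ≤ 1 - r := by linarith
  positivity

lemma subsetExp_congr {A : Finset β} {r : ℝ} {f g : Finset β → ℝ}
    (h : ∀ W ⊆ A, f W = g W) : subsetExp A r f = subsetExp A r g :=
  sum_congr rfl fun W hW => by rw [h W (mem_powerset.1 hW)]

lemma subsetExp_add (A : Finset β) (r : ℝ) (f g : Finset β → ℝ) :
    subsetExp A r (fun W => f W + g W) = subsetExp A r f + subsetExp A r g := by
  simp only [subsetExp, mul_add, sum_add_distrib]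

lemma subsetExp_mul_left (A : Finset β) (r c : ℝ) (f : Finset β → ℝ) :
    subsetExp A r (fun W => c * f W) = c * subsetExp A r f := by
  simp only [subsetExp, mul_sum]
  exact sum_congr rfl fun _ _ => by ring

lemma subsetExp_sum {ι : Type*} (A : Finset β) (r : ℝ) (s : Finset ι) (f : ι → Finset β → ℝ) :
    subsetExp A r (fun W => ∑ i ∈ s, f i W) = ∑ i ∈ s, subsetExp A r (f i) := by
  simp only [subsetExp, mul_sum]
  exact sum_comm

variable [DecidableEq β]

lemma subsetExp_insert {A : Finset β} {a : β} (ha : a ∉ A) (r : ℝ) (f : Finset β → ℝ) :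
    subsetExp (insert a A) r f =
      (1 - r) * subsetExp A r f + r * subsetExp A r (fun W => f (insert a W)) := by
  simp only [subsetExp]
  rw [sum_powerset_insert ha, mul_sum, mul_sum]
  congr 1 <;> refine sum_congr rfl fun W hW => ?_
  · have := card_le_card (mem_powerset.1 hW)
    rw [card_insert_of_notMem ha, Nat.sub_add_comm this, pow_succ]
    ring
  · rw [card_insert_of_notMem ha,
      card_insert_of_notMem fun h => ha (mem_powerset.1 hW h), Nat.add_sub_add_right, pow_succ]
    ring

lemma subsetExp_const (A : Finset β) (r c : ℝ) : subsetExp A r (fun _ => c) = c := by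
  induction A using Finset.induction_on with
  | empty => exact subsetExp_empty _ _
  | insert a A ha ih => rw [subsetExp_insert ha, ih]; ring

lemma subsetExp_union {A B : Finset β} (h : Disjoint A B) (r : ℝ) (f : Finset β → ℝ) :
    subsetExp (A ∪ B) r f = subsetExp A r fun W => subsetExp B r fun V => f (W ∪ V) := by
  induction A using Finset.induction_on generalizing f with
  | empty => simp [subsetExp_empty]
  | insert a A ha ih =>
    have h' := disjoint_insert_left.1 h
    have : a ∉ A ∪ B := by simp [ha, h'.1]
    rw [insert_union, subsetExp_insert this, subsetExp_insert ha, ih h'.2, ih h'.2]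
    simp only [insert_union]

/-- The union of two independent random subsets is a random subset. -/
lemma subsetExp_subsetExp_union (A : Finset β) (r s : ℝ) (f : Finset β → ℝ) :
    subsetExp A r (fun W => subsetExp A s fun V => f (W ∪ V)) =
      subsetExp A (r + s - r * s) f := by
  induction A using Finset.induction_on generalizing f with
  | empty => simp [subsetExp_empty]
  | insert a A ha ih =>
    simp only [subsetExp_insert ha, subsetExp_add, subsetExp_mul_left, insert_union,
      union_insert, insert_idem, ih]
    rw [ih fun W => f (insert a W)]
    ring

lemma subsetExp_le_of_antitone {A : Finset β} {r s : ℝ} (hr : 0 ≤ r) (hrs : r ≤ s) (hs : s < 1)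
    {f : Finset β → ℝ} (hf : Antitone f) : subsetExp A s f ≤ subsetExp A r f := by
  have hr1 : 0 < 1 - r := by linarith
  have hs' : s = r + (s - r) / (1 - r) - r * ((s - r) / (1 - r)) := by field_simp; ring
  rw [hs', ← subsetExp_subsetExp_union]
  refine subsetExp_mono hr (by linarith) fun W _ => ?_
  refine (subsetExp_mono (div_nonneg (by linarith) hr1.le) ?_
    fun V _ => hf (subset_union_left (s₂ := V))).trans_eq (subsetExp_const _ _ _)
  rw [div_le_one hr1]; linarith

lemma subsetExp_sum_mem (A : Finset β) (r : ℝ) (h : β → ℝ) :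
    subsetExp A r (fun W => ∑ b ∈ W, h b) = r * ∑ b ∈ A, h b := by
  induction A using Finset.induction_on with
  | empty => simp [subsetExp_empty]
  | insert a A ha ih =>
    have : subsetExp A r (fun W => ∑ b ∈ insert a W, h b) =
        subsetExp A r (fun W => h a + ∑ b ∈ W, h b) :=
      subsetExp_congr fun W hW => sum_insert fun h => ha (hW h)
    rw [subsetExp_insert ha, this, subsetExp_add, subsetExp_const, ih, sum_insert ha]
    ring

end SubsetExp

/-- The sets of coloured elements of `A` in which every element has at most one colour. -/
def partialColorings {α : Type*} [DecidableEq α] (A : Finset α) (k : ℕ) :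
    Finset (Finset (α × Fin k)) :=
  (A ×ˢ univ).powerset.filter fun S => (S.image Prod.fst).card = S.card

/-- The expectation of `f S`, where every element of `A` belongs to the random coloured set `S`
independently with probability `p`, and then carries a uniformly random colour. -/
noncomputable def coloredExp {α : Type*} [DecidableEq α] (A : Finset α) (k : ℕ) (p : ℝ)
    (f : Finset (α × Fin k) → ℝ) : ℝ :=
  ∑ S ∈ partialColorings A k, (p / (k : ℝ)) ^ S.card * (1 - p) ^ (A.card - S.card) * f S

section ColoredExp

variable {α : Type*} [DecidableEq α] {k : ℕ}

lemma mem_partialColorings {A : Finset α} {S : Finset (α × Fin k)} :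
    S ∈ partialColorings A k ↔
      (∀ z ∈ S, z.1 ∈ A) ∧ ∀ z ∈ S, ∀ w ∈ S, z.1 = w.1 → z = w := by
  rw [partialColorings, mem_filter, mem_powerset, card_image_iff]
  refine and_congr ⟨fun h z hz => (mem_product.1 (h hz)).1, fun h z hz => by simp [h z hz]⟩ ?_
  exact ⟨fun h z hz w hw e => h hz hw e, fun h z hz w hw e => h z hz w hw e⟩

lemma card_le_of_mem_partialColorings {A : Finset α} {S : Finset (α × Fin k)}
    (hS : S ∈ partialColorings A k) : S.card ≤ A.card := by
  rw [← (mem_filter.1 hS).2]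
  refine card_le_card fun x hx => ?_
  obtain ⟨z, hz, rfl⟩ := mem_image.1 hx
  exact (mem_partialColorings.1 hS).1 z hz

lemma notMem_of_mem_partialColorings {A : Finset α} {a : α} (ha : a ∉ A)
    {S : Finset (α × Fin k)} (hS : S ∈ partialColorings A k) (i : Fin k) : (a, i) ∉ S :=
  fun h => ha ((mem_partialColorings.1 hS).1 _ h)

lemma partialColorings_insert {A : Finset α} {a : α} (ha : a ∉ A) :
    partialColorings (insert a A) k = partialColorings A k ∪
      univ.biUnion fun i => (partialColorings A k).image (insert (a, i)) := by
  ext S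
  simp only [mem_union, mem_biUnion, mem_univ, true_and, mem_image]
  constructor
  · intro hS
    obtain ⟨h1, h2⟩ := mem_partialColorings.1 hS
    by_cases h : ∃ i, (a, i) ∈ S
    · obtain ⟨i, hi⟩ := h
      refine Or.inr ⟨i, S.erase (a, i), mem_partialColorings.2 ⟨fun z hz => ?_,
        fun z hz w hw => h2 z (mem_of_mem_erase hz) w (mem_of_mem_erase hw)⟩, insert_erase hi⟩
      refine mem_of_mem_insert_of_ne (h1 z (mem_of_mem_erase hz)) fun e => ?_
      exact ne_of_mem_erase hz (h2 z (mem_of_mem_erase hz) _ hi e)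
    · refine Or.inl (mem_partialColorings.2 ⟨fun z hz => ?_, h2⟩)
      refine mem_of_mem_insert_of_ne (h1 z hz) fun e => h ⟨z.2, ?_⟩
      rwa [← e]
  · rintro (hS | ⟨i, S, hS, rfl⟩)
    · obtain ⟨h1, h2⟩ := mem_partialColorings.1 hS
      exact mem_partialColorings.2 ⟨fun z hz => mem_insert_of_mem (h1 z hz), h2⟩
    · obtain ⟨h1, h2⟩ := mem_partialColorings.1 hS
      refine mem_partialColorings.2 ⟨fun z hz => ?_, fun z hz w hw e => ?_⟩
      · obtain rfl | hz := mem_insert.1 hz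
        · exact mem_insert_self _ _
        · exact mem_insert_of_mem (h1 z hz)
      · obtain rfl | hz := mem_insert.1 hz <;> obtain rfl | hw := mem_insert.1 hw
        · rfl
        · exact (ha ((show a = w.1 from e) ▸ h1 w hw)).elim
        · exact (ha ((show z.1 = a from e) ▸ h1 z hz)).elim
        · exact h2 z hz w hw e

lemma sum_partialColorings_insert {A : Finset α} {a : α} (ha : a ∉ A)
    (f : Finset (α × Fin k) → ℝ) :
    ∑ S ∈ partialColorings (insert a A) k, f S = ∑ S ∈ partialColorings A k, f S +
      ∑ i : Fin k, ∑ S ∈ partialColorings A k, f (insert (a, i) S) := by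
  rw [partialColorings_insert ha, sum_union, sum_biUnion]
  · congr 1
    refine sum_congr rfl fun i _ => sum_image fun S hS T hT e => ?_
    rw [← erase_insert (notMem_of_mem_partialColorings ha hS i),
      ← erase_insert (notMem_of_mem_partialColorings ha hT i), e]
  · intro i _ j _ hij
    refine disjoint_left.2 fun T hT hT' => hij ?_
    obtain ⟨S, hS, rfl⟩ := mem_image.1 hT
    obtain ⟨S', hS', e⟩ := mem_image.1 hT'
    have h : (a, i) ∈ insert (a, j) S' := e ▸ mem_insert_self _ _
    obtain h | h := mem_insert.1 h
    · exact (Prod.mk.inj h).2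
    · exact (notMem_of_mem_partialColorings ha hS' i h).elim
  · refine disjoint_left.2 fun T hT hT' => ?_
    obtain ⟨i, _, hT'⟩ := mem_biUnion.1 hT'
    obtain ⟨S, hS, rfl⟩ := mem_image.1 hT'
    exact notMem_of_mem_partialColorings ha hT i (mem_insert_self _ _)

lemma coloredExp_empty (p : ℝ) (f : Finset (α × Fin k) → ℝ) : coloredExp ∅ k p f = f ∅ := by
  simp [coloredExp, partialColorings, filter_singleton]

lemma coloredExp_insert {A : Finset α} {a : α} (ha : a ∉ A) (p : ℝ)
    (f : Finset (α × Fin k) → ℝ) :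
    coloredExp (insert a A) k p f = (1 - p) * coloredExp A k p f +
      p / k * ∑ i : Fin k, coloredExp A k p (fun S => f (insert (a, i) S)) := by
  simp only [coloredExp]
  rw [sum_partialColorings_insert ha, mul_sum, mul_sum]
  congr 1
  · refine sum_congr rfl fun S hS => ?_
    rw [card_insert_of_notMem ha, Nat.sub_add_comm (card_le_of_mem_partialColorings hS), pow_succ]
    ring
  · refine sum_congr rfl fun i _ => ?_
    rw [mul_sum]
    refine sum_congr rfl fun S hS => ?_
    rw [card_insert_of_notMem ha, card_insert_of_notMem (notMem_of_mem_partialColorings ha hS i),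
      Nat.add_sub_add_right, pow_succ]
    ring

lemma coloredExp_mono {A : Finset α} {p : ℝ} (h0 : 0 ≤ p) (h1 : p ≤ 1)
    {f g : Finset (α × Fin k) → ℝ} (h : ∀ S ∈ partialColorings A k, f S ≤ g S) :
    coloredExp A k p f ≤ coloredExp A k p g := by
  refine sum_le_sum fun S hS => mul_le_mul_of_nonneg_left (h S hS) ?_
  have : 0 ≤ 1 - p := by linarith
  positivity

lemma coloredExp_congr {A : Finset α} {p : ℝ} {f g : Finset (α × Fin k) → ℝ}
    (h : ∀ S ∈ partialColorings A k, f S = g S) : coloredExp A k p f = coloredExp A k p g :=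
  sum_congr rfl fun S hS => by rw [h S hS]

lemma coloredExp_zero (A : Finset α) (p : ℝ) :
    coloredExp A k p (fun _ => 0) = 0 := by
  simp [coloredExp]

lemma coloredExp_sum {ι : Type*} (A : Finset α) (p : ℝ) (s : Finset ι) (c : ι → ℝ)
    (f : ι → Finset (α × Fin k) → ℝ) :
    coloredExp A k p (fun S => ∑ i ∈ s, c i * f i S) = ∑ i ∈ s, c i * coloredExp A k p (f i) := by
  simp only [coloredExp, mul_sum]
  rw [sum_comm]
  exact sum_congr rfl fun _ _ => sum_congr rfl fun _ _ => by ring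

/-- The set of elements receiving a colour contains `B` with probability `p ^ |B|`. -/
lemma coloredExp_subset_image (hk : k ≠ 0) (p : ℝ) {A B : Finset α} (hB : B ⊆ A) :
    coloredExp A k p (fun S => if B ⊆ S.image Prod.fst then 1 else 0) = p ^ B.card := by
  induction A using Finset.induction_on generalizing B with
  | empty => simp [subset_empty.1 hB, coloredExp_empty]
  | insert a A ha ih =>
    have hk' : (k : ℝ) ≠ 0 := by exact_mod_cast hk
    have hi : ∀ i : Fin k, coloredExp A k p
        (fun S => if B ⊆ (insert (a, i) S).image Prod.fst then 1 else 0) =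
          p ^ (B.erase a).card := fun i => by
      rw [← ih (subset_insert_iff.1 hB)]
      refine coloredExp_congr fun S _ => ?_
      simp only [image_insert, subset_insert_iff]
    simp only [coloredExp_insert ha, hi, sum_const, card_univ, Fintype.card_fin, nsmul_eq_mul]
    by_cases haB : a ∈ B
    · have h0 : coloredExp A k p (fun S => if B ⊆ S.image Prod.fst then (1 : ℝ) else 0) = 0 := by
        refine (coloredExp_congr fun S hS => if_neg fun h => ?_).trans (coloredExp_zero A p)
        obtain ⟨z, hz, rfl⟩ := mem_image.1 (h haB)
        exact ha ((mem_partialColorings.1 hS).1 z hz)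
      rw [h0, ← card_erase_add_one haB, pow_succ]
      field_simp
      ring
    · have hBA : B ⊆ A := fun x hx => mem_of_mem_insert_of_ne (hB hx) fun e => haB (e ▸ hx)
      rw [ih hBA, erase_eq_of_notMem haB]
      field_simp
      ring

/-- If adding several colours of one element never gains more than adding them separately, then
giving every element at most one colour is at least as good as including all coloured elements
independently. -/
lemma subsetExp_le_coloredExp (hk : k ≠ 0) {p : ℝ} (h0 : 0 ≤ p) (h1 : p ≤ 1) (A : Finset α)
    (f : Finset (α × Fin k) → ℝ)
    (hf : ∀ a ∈ A, ∀ (C : Finset (Fin k)) (W : Finset (α × Fin k)),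
      f (W ∪ ({a} : Finset α) ×ˢ C) ≤ f W + ∑ i ∈ C, (f (insert (a, i) W) - f W)) :
    subsetExp (A ×ˢ univ) (p / k) f ≤ coloredExp A k p f := by
  induction A using Finset.induction_on generalizing f with
  | empty => simp [coloredExp_empty, subsetExp_empty]
  | insert a A ha ih =>
    have hk1 : (1 : ℝ) ≤ k := by exact_mod_cast Nat.one_le_iff_ne_zero.2 hk
    have hk' : (k : ℝ) ≠ 0 := by positivity
    have hr0 : 0 ≤ p / k := by positivity
    have hr1 : p / k ≤ 1 := (div_le_self h0 hk1).trans h1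
    have hdisj : Disjoint (A ×ˢ (univ : Finset (Fin k))) ({a} ×ˢ univ) :=
      disjoint_left.2 fun z hz hz' => ha (by
        have := mem_singleton.1 (mem_product.1 hz').1
        exact this ▸ (mem_product.1 hz).1)
    have hsplit : insert a A ×ˢ (univ : Finset (Fin k)) = A ×ˢ univ ∪ {a} ×ˢ univ := by
      rw [insert_eq, union_comm, union_product]
    have key : ∀ W, subsetExp ({a} ×ˢ (univ : Finset (Fin k))) (p / k) (fun V => f (W ∪ V)) ≤
        (1 - p) * f W + ∑ i : Fin k, p / k * f (insert (a, i) W) := fun W => by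
      have hV : ∀ V ⊆ ({a} : Finset α) ×ˢ (univ : Finset (Fin k)),
          f (W ∪ V) ≤ f W + ∑ z ∈ V, (f (insert z W) - f W) := fun V hV => by
        have hV' : V = ({a} : Finset α) ×ˢ V.image Prod.snd := by
          ext ⟨x, i⟩
          simp only [mem_product, mem_singleton, mem_image, Prod.exists, exists_eq_right]
          constructor
          · intro h
            exact ⟨by simpa [eq_comm] using hV h, x, h⟩
          · rintro ⟨rfl, y, hy⟩
            have : y = x := by simpa [eq_comm] using hV hy
            exact this ▸ hy
        have := hf a (mem_insert_self _ _) (V.image Prod.snd) W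
        rw [← hV'] at this
        rw [hV', sum_product, sum_singleton, ← hV']
        exact this
      refine (subsetExp_mono hr0 hr1 hV).trans_eq ?_
      rw [subsetExp_add, subsetExp_const, subsetExp_sum_mem, sum_product, sum_singleton,
        sum_sub_distrib, sum_const, card_univ, Fintype.card_fin, nsmul_eq_mul, ← mul_sum]
      field_simp
      ring
    rw [hsplit, subsetExp_union hdisj, coloredExp_insert ha]
    refine (subsetExp_mono hr0 hr1 fun W _ => key W).trans ?_
    rw [subsetExp_add, subsetExp_mul_left, subsetExp_sum, mul_sum]
    refine add_le_add (mul_le_mul_of_nonneg_left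
      (ih f fun b hb => hf b (mem_insert_of_mem hb)) (by linarith)) (sum_le_sum fun i _ => ?_)
    rw [subsetExp_mul_left]
    refine mul_le_mul_of_nonneg_left (ih _ fun b hb C W => ?_) hr0
    have := hf b (mem_insert_of_mem hb) C (insert (a, i) W)
    simpa only [insert_union, Finset.insert_comm _ (a, i)] using this

lemma muk_eq_coloredExp [Fintype α] (p : ℝ) (F' : Finset (Finset (α × Fin k))) :
    muk p k F' = coloredExp univ k p (fun S => if S ∈ F' then 1 else 0) := by
  simp only [muk, coloredExp, partialColorings, univ_product_univ, powerset_univ, sum_filter,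
    card_univ, mul_ite, mul_one, mul_zero]
  rw [← filter_univ_mem F', sum_filter]
  refine sum_congr rfl fun S _ => ?_
  simp only [mem_filter, mem_univ, true_and]
  split_ifs <;> rfl

end ColoredExp
section Minimals

variable {β : Type*} [DecidableEq β]

lemma mem_of_mem_minimals {F : Finset (Finset β)} {A : Finset β} (hA : A ∈ minimals F) :
    A ∈ F :=
  (mem_filter.1 hA).1

lemma exists_minimals_subset {F : Finset (Finset β)} {A : Finset β} (hA : A ∈ F) :
    ∃ B ∈ minimals F, B ⊆ A := by
  obtain ⟨B, hBA, hB⟩ := F.exists_le_minimal hA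
  exact ⟨B, mem_filter.2 ⟨hB.prop, fun C hC hCB => hCB.antisymm (hB.le_of_le hC hCB)⟩, hBA⟩

/-- The indicator of the event that `W` contains no member of `H`. -/
noncomputable def missIndicator (H : Finset (Finset β)) (W : Finset β) : ℝ :=
  if ∃ S ∈ H, S ⊆ W then 0 else 1

lemma missIndicator_nonneg (H : Finset (Finset β)) (W : Finset β) : 0 ≤ missIndicator H W := by
  unfold missIndicator; split_ifs <;> norm_num

lemma missIndicator_le_one (H : Finset (Finset β)) (W : Finset β) : missIndicator H W ≤ 1 := by
  unfold missIndicator; split_ifs <;> norm_num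

lemma missIndicator_le {H H' : Finset (Finset β)} {W W' : Finset β}
    (h : (∃ S ∈ H', S ⊆ W') → ∃ S ∈ H, S ⊆ W) : missIndicator H W ≤ missIndicator H' W' := by
  by_cases h' : ∃ S ∈ H', S ⊆ W'
  · exact (if_pos (h h')).trans_le (missIndicator_nonneg _ _)
  · exact (missIndicator_le_one _ _).trans_eq (if_neg h').symm

lemma missIndicator_antitone (H : Finset (Finset β)) : Antitone (missIndicator H) :=
  fun _ _ hVW => missIndicator_le fun ⟨S, hS, hSV⟩ => ⟨S, hS, hSV.trans hVW⟩

/-- The minimal parts of the members of `H` that remain to be covered outside `W`. -/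
def residues (H : Finset (Finset β)) (W : Finset β) : Finset (Finset β) :=
  minimals (H.image (· \ W))

lemma exists_of_mem_residues {H : Finset (Finset β)} {W T : Finset β} (hT : T ∈ residues H W) :
    ∃ S ∈ H, S \ W = T :=
  mem_image.1 (mem_of_mem_minimals hT)

lemma disjoint_of_mem_residues {H : Finset (Finset β)} {W T : Finset β}
    (hT : T ∈ residues H W) : Disjoint T W := by
  obtain ⟨S, -, rfl⟩ := exists_of_mem_residues hT
  exact sdiff_disjoint

lemma exists_residues_subset {H : Finset (Finset β)} {S : Finset β} (hS : S ∈ H)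
    (W : Finset β) : ∃ T ∈ residues H W, T ⊆ S := by
  obtain ⟨T, hT, hTS⟩ := exists_minimals_subset (mem_image_of_mem (· \ W) hS)
  exact ⟨T, hT, hTS.trans sdiff_subset⟩

/-- A residue is contained in every member of `H` inside the union of `W` and the residue. -/
lemma residue_subset {H : Finset (Finset β)} {W T S : Finset β} (hT : T ∈ residues H W)
    (hS : S ∈ H) (hSW : S ⊆ W ∪ T) : T ⊆ S := by
  rw [← (mem_filter.1 hT).2 (S \ W) (mem_image_of_mem _ hS)
    (sdiff_le_iff.2 hSW)]
  exact sdiff_subset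

variable [Fintype β]

/-- The expected cost of the residues of size at least `t`. -/
lemma subsetExp_sum_residues_le {H : Finset (Finset β)} {m t : ℕ} (hm : ∀ S ∈ H, S.card ≤ m)
    {p L : ℝ} (hp : 0 ≤ p) (hL : 1 ≤ L) (hLp : L * p ≤ 1) :
    subsetExp univ (L * p) (fun W => ∑ T ∈ residues H W with t ≤ T.card, p ^ T.card) ≤
      2 ^ m / L ^ t := by
  have hL0 : 0 < L := by linarith
  have hr0 : 0 ≤ L * p := by positivity
  have hr1 : 0 ≤ 1 - L * p := by linarith
  set w : Finset β → ℝ := fun W => (L * p) ^ W.card * (1 - L * p) ^ (Fintype.card β - W.card)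
    with hw
  have hw0 : ∀ W, 0 ≤ w W := fun W => by positivity
  have hE : ∀ Z : Finset β, ∃ E : Finset β, E.card ≤ m ∧ ((∃ S ∈ H, S ⊆ Z) → E ∈ H ∧ E ⊆ Z) := by
    intro Z
    by_cases h : ∃ S ∈ H, S ⊆ Z
    · obtain ⟨S, hS, hSZ⟩ := h
      exact ⟨S, hm S hS, fun _ => ⟨hS, hSZ⟩⟩
    · exact ⟨∅, by simp, fun h' => absurd h' h⟩
  choose E hEm hE using hE
  have hterm : ∀ W T : Finset β, Disjoint T W →
      w W * p ^ T.card ≤ w (W ∪ T) * (1 / L) ^ T.card := by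
    intro W T hTW
    have h1 : (W ∪ T).card = W.card + T.card := card_union_of_disjoint hTW.symm
    have h2 : (1 - L * p) ^ (Fintype.card β - W.card) ≤
        (1 - L * p) ^ (Fintype.card β - (W ∪ T).card) :=
      pow_le_pow_of_le_one hr1 (by linarith) (by omega)
    calc w W * p ^ T.card
        ≤ (L * p) ^ W.card * (1 - L * p) ^ (Fintype.card β - (W ∪ T).card) * p ^ T.card := by
          simp only [hw]; gcongr
      _ = w (W ∪ T) * (1 / L) ^ T.card := by
          simp only [hw]
          rw [h1, pow_add, mul_pow L p T.card, one_div, inv_pow]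
          field_simp
  calc subsetExp univ (L * p) (fun W => ∑ T ∈ residues H W with t ≤ T.card, p ^ T.card)
      = ∑ x ∈ univ.sigma fun W => (residues H W).filter fun T => t ≤ T.card,
          w x.1 * p ^ x.2.card := by
        simp only [subsetExp, powerset_univ, card_univ, mul_sum, hw]
        rw [sum_sigma']
    _ ≤ ∑ x ∈ univ.sigma fun W => (residues H W).filter fun T => t ≤ T.card,
          w (x.1 ∪ x.2) * (1 / L) ^ x.2.card := by
        refine sum_le_sum fun x hx => hterm _ _ ?_
        exact disjoint_of_mem_residues (mem_filter.1 (mem_sigma.1 hx).2).1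
    _ = ∑ y ∈ (univ.sigma fun W => (residues H W).filter fun T => t ≤ T.card).image
          (fun x : Σ _ : Finset β, Finset β => (⟨x.1 ∪ x.2, x.2⟩ : Σ _ : Finset β, Finset β)),
          w y.1 * (1 / L) ^ y.2.card := by
        rw [sum_image]
        intro x hx y hy e
        have hx := disjoint_of_mem_residues (mem_filter.1 (mem_sigma.1 (mem_coe.1 hx)).2).1
        have hy := disjoint_of_mem_residues (mem_filter.1 (mem_sigma.1 (mem_coe.1 hy)).2).1
        obtain ⟨W, T⟩ := x
        obtain ⟨V, T'⟩ := y
        simp only [Sigma.mk.injEq, heq_eq_eq] at e hx hy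
        obtain ⟨e, rfl⟩ := e
        have : W = V := by
          rw [← union_sdiff_cancel_right hx.symm, e, union_sdiff_cancel_right hy.symm]
        rw [this]
    _ ≤ ∑ y ∈ univ.sigma fun Z => (E Z).powerset.filter fun T => t ≤ T.card,
          w y.1 * (1 / L) ^ y.2.card := by
        refine sum_le_sum_of_subset_of_nonneg (fun y hy => ?_) fun y _ _ =>
          mul_nonneg (hw0 _) (by positivity)
        obtain ⟨⟨W, T⟩, hx, rfl⟩ := mem_image.1 hy
        obtain ⟨hT, ht⟩ := mem_filter.1 (mem_sigma.1 hx).2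
        obtain ⟨S, hS, hST⟩ := exists_of_mem_residues hT
        have hSW : S ⊆ W ∪ T := sdiff_le_iff.1 hST.le
        obtain ⟨hEH, hEZ⟩ := hE (W ∪ T) ⟨S, hS, hSW⟩
        simp only [mem_sigma, mem_univ, true_and, mem_filter, mem_powerset]
        exact ⟨residue_subset hT hEH hEZ, ht⟩
    _ = ∑ Z : Finset β, w Z * ∑ T ∈ (E Z).powerset with t ≤ T.card, (1 / L) ^ T.card := by
        simp only [mul_sum]
        rw [sum_sigma']
    _ ≤ ∑ Z : Finset β, w Z * (2 ^ m / L ^ t) := by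
        refine sum_le_sum fun Z _ => mul_le_mul_of_nonneg_left ?_ (hw0 Z)
        have hbound : ∀ T ∈ (E Z).powerset.filter fun T => t ≤ T.card,
            (1 / L) ^ T.card ≤ 1 / L ^ t := fun T hT => by
          rw [← one_div_pow]
          exact pow_le_pow_of_le_one (by positivity) ((div_le_one hL0).2 hL) (mem_filter.1 hT).2
        refine (sum_le_card_nsmul _ _ _ hbound).trans ?_
        rw [nsmul_eq_mul, mul_one_div]
        have hcard : ((E Z).powerset.filter fun T => t ≤ T.card).card ≤ 2 ^ m :=
          (card_filter_le _ _).trans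
            ((card_powerset _).trans_le (Nat.pow_le_pow_right two_pos (hEm Z)))
        gcongr
        exact_mod_cast hcard
    _ = 2 ^ m / L ^ t := by
        have := subsetExp_const (univ : Finset β) (L * p) (2 ^ m / L ^ t)
        simpa only [subsetExp, powerset_univ, card_univ] using this

/-- If every family covering `H` costs at least `c` at density `p`, and the members of `H` have
size less than `2 ^ n`, then the union of `n` random sets of density `32 p` contains a member
of `H` unless an event of probability at most `1 / (7 c)` occurs. -/
lemma subsetExp_missIndicator_mul_le {p : ℝ} (hp : 0 ≤ p) (hp1 : 32 * p ≤ 1) (n : ℕ)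
    (H : Finset (Finset β)) (hH : ∀ S ∈ H, S.card < 2 ^ n) (c : ℝ)
    (hc : ∀ G : Finset (Finset β), (∀ S ∈ H, ∃ T ∈ G, T ⊆ S) → c ≤ ∑ T ∈ G, p ^ T.card) :
    subsetExp univ (1 - (1 - 32 * p) ^ n) (missIndicator H) * c ≤ (1 - (1 / 8) ^ n) / 7 := by
  have hr0 : 0 ≤ 1 - 32 * p := by linarith
  have hR0 : ∀ n : ℕ, 0 ≤ 1 - (1 - 32 * p) ^ n := fun n =>
    sub_nonneg.2 (pow_le_one₀ hr0 (by linarith))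
  have hR1 : ∀ n : ℕ, 1 - (1 - 32 * p) ^ n ≤ 1 := fun n => sub_le_self _ (by positivity)
  have hδ : ∀ n : ℕ, (0 : ℝ) ≤ (1 - (1 / 8) ^ n) / 7 := fun n =>
    div_nonneg (sub_nonneg.2 (pow_le_one₀ (by norm_num) (by norm_num))) (by norm_num)
  have hE0 : ∀ (n : ℕ) (H : Finset (Finset β)),
      0 ≤ subsetExp univ (1 - (1 - 32 * p) ^ n) (missIndicator H) := fun n H => by
    rw [← subsetExp_const (univ : Finset β) (1 - (1 - 32 * p) ^ n) 0]
    exact subsetExp_mono (hR0 n) (hR1 n) fun W _ => missIndicator_nonneg H W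
  induction n generalizing H c with
  | zero =>
    have hH' : ∀ S ∈ H, S = ∅ := fun S hS => by simpa using hH S hS
    by_cases h : ∅ ∈ H
    · have h0 : missIndicator H = fun _ => 0 := by
        funext W
        exact if_pos ⟨∅, h, empty_subset _⟩
      rw [h0, subsetExp_const]
      simp
    · have : c ≤ 0 := by
        simpa using hc ∅ fun S hS => absurd (hH' S hS ▸ hS) h
      simpa using mul_nonpos_of_nonneg_of_nonpos (hE0 0 H) this
  | succ n ih =>
    obtain hc0 | hc0 := lt_or_ge c 0
    · exact (mul_nonpos_of_nonneg_of_nonpos (hE0 _ H) hc0.le).trans (hδ _)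
    set R := 1 - (1 - 32 * p) ^ n with hR
    set U : Finset β → Finset (Finset β) := fun W => (residues H W).filter fun T => 2 ^ n ≤ T.card
      with hU
    set H₁ : Finset β → Finset (Finset β) := fun W => (residues H W).filter fun T => T.card < 2 ^ n
      with hH₁
    have hstep : ∀ W, c * subsetExp univ R (fun V => missIndicator H (W ∪ V)) ≤
        (1 - (1 / 8) ^ n) / 7 + ∑ T ∈ U W, p ^ T.card := by
      intro W
      have hU0 : 0 ≤ ∑ T ∈ U W, p ^ T.card := sum_nonneg fun T _ => by positivity
      have h1 : subsetExp univ R (fun V => missIndicator H (W ∪ V)) ≤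
          subsetExp univ R (missIndicator (H₁ W)) := by
        refine subsetExp_mono (hR0 n) (hR1 n) fun V _ => missIndicator_le ?_
        rintro ⟨T, hT, hTV⟩
        obtain ⟨S, hS, rfl⟩ := exists_of_mem_residues (mem_filter.1 hT).1
        exact ⟨S, hS, sdiff_le_iff.1 hTV⟩
      have h2 := ih (H₁ W) (fun T hT => (mem_filter.1 hT).2) (c - ∑ T ∈ U W, p ^ T.card) (by
        intro G hG
        have hcov : c ≤ ∑ T ∈ U W ∪ G, p ^ T.card := hc _ fun S hS => by
          obtain ⟨T, hT, hTS⟩ := exists_residues_subset hS W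
          obtain ht | ht := le_or_gt (2 ^ n) T.card
          · exact ⟨T, mem_union_left _ (mem_filter.2 ⟨hT, ht⟩), hTS⟩
          · obtain ⟨T', hT', hTT'⟩ := hG T (mem_filter.2 ⟨hT, ht⟩)
            exact ⟨T', mem_union_right _ hT', hTT'.trans hTS⟩
        have hun := sum_union_inter (s₁ := U W) (s₂ := G) (f := fun T => p ^ T.card)
        have hin : 0 ≤ ∑ T ∈ U W ∩ G, p ^ T.card := sum_nonneg fun T _ => by positivity
        linarith)
      have h3 : subsetExp univ R (missIndicator (H₁ W)) ≤ 1 := by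
        rw [← subsetExp_const (univ : Finset β) R 1]
        exact subsetExp_mono (hR0 n) (hR1 n) fun W _ => missIndicator_le_one _ W
      have h4 := mul_le_mul_of_nonneg_left h1 hc0
      have h5 := mul_le_mul_of_nonneg_right h3 hU0
      linarith
    have hcost := subsetExp_sum_residues_le (t := 2 ^ n) (fun S hS => (hH S hS).le) hp
      (by norm_num : (1 : ℝ) ≤ 32) hp1
    have hnum : (2 : ℝ) ^ 2 ^ (n + 1) / 32 ^ 2 ^ n ≤ (1 / 8) ^ (n + 1) := by
      rw [pow_succ 2 n, mul_comm (2 ^ n) 2, pow_mul, ← div_pow]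
      norm_num only
      exact pow_le_pow_of_le_one (by norm_num) (by norm_num) (Nat.lt_two_pow_self)
    have hdens : 1 - (1 - 32 * p) ^ (n + 1) = 32 * p + R - 32 * p * R := by rw [hR]; ring
    rw [hdens, ← subsetExp_subsetExp_union, mul_comm, ← subsetExp_mul_left]
    refine (subsetExp_mono (by positivity) hp1 fun W _ => hstep W).trans ?_
    rw [subsetExp_add, subsetExp_const]
    refine (add_le_add_right (hcost.trans hnum) _).trans_eq ?_
    ring

end Minimals
section Rainbow

variable {α : Type*} [DecidableEq α] {k : ℕ}

/-- The number of injective colourings of `T` extending a rainbow partial colouring `S`. -/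
lemma card_embedding_extending_le {T : Finset α} {S : Finset (α × Fin k)}
    (hfst : (S.image Prod.fst).card = S.card) (hsnd : (S.image Prod.snd).card = S.card)
    (hST : S.image Prod.fst ⊆ T) :
    (univ.filter fun c : T ↪ Fin k => ∀ z ∈ S, ∃ h : z.1 ∈ T, c ⟨z.1, h⟩ = z.2).card ≤
      (k - S.card).descFactorial (T.card - S.card) := by
  have hcard : Fintype.card
      (↥(T \ S.image Prod.fst) ↪ ↥((univ : Finset (Fin k)) \ S.image Prod.snd)) =
      (k - S.card).descFactorial (T.card - S.card) := by
    rw [Fintype.card_embedding_eq, Fintype.card_coe, Fintype.card_coe, card_sdiff_of_subset hST,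
      card_sdiff_of_subset (subset_univ _), hfst, hsnd, card_univ, Fintype.card_fin]
  rw [← hcard, ← Fintype.card_subtype]
  refine Fintype.card_le_of_injective (fun c => ⟨fun x => ⟨c.1 ⟨x.1, (mem_sdiff.1 x.2).1⟩, ?_⟩,
    fun x y e => ?_⟩) fun c c' e => ?_
  · refine mem_sdiff.2 ⟨mem_univ _, fun h => (mem_sdiff.1 x.2).2 ?_⟩
    obtain ⟨z, hz, hzx⟩ := mem_image.1 h
    obtain ⟨hzT, hcz⟩ := c.2 z hz
    have := c.1.injective (hcz.trans hzx)
    exact mem_image.2 ⟨z, hz, congrArg Subtype.val this⟩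
  · have := c.1.injective (congrArg Subtype.val e)
    exact Subtype.ext (Subtype.mk.inj this)
  · refine Subtype.ext (DFunLike.ext _ _ fun x => ?_)
    by_cases hx : x.1 ∈ S.image Prod.fst
    · obtain ⟨z, hz, hzx⟩ := mem_image.1 hx
      obtain ⟨h, hc⟩ := c.2 z hz
      obtain ⟨h', hc'⟩ := c'.2 z hz
      have hzx' : (⟨z.1, h⟩ : T) = x := Subtype.ext hzx
      rw [← hzx', hc, hc']
    · have := DFunLike.congr_fun e ⟨x.1, mem_sdiff.2 ⟨x.2, hx⟩⟩
      exact congrArg Subtype.val this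

lemma pow_le_three_pow_mul_descFactorial {k s : ℕ} (hs : s ≤ k) :
    (k : ℝ) ^ s ≤ 3 ^ s * k.descFactorial s := by
  have h1 : k ^ s * s.factorial ≤ s ^ s * k.descFactorial s := by
    rw [← Nat.descFactorial_self, Nat.descFactorial_eq_prod_range, Nat.descFactorial_eq_prod_range]
    have hconst : ∀ a : ℕ, a ^ s = ∏ _i ∈ range s, a := fun a => by simp
    rw [hconst k, hconst s]
    rw [← prod_mul_distrib, ← prod_mul_distrib]
    refine prod_le_prod' fun i hi => ?_
    have hi := mem_range.1 hi
    zify [hi.le, hi.le.trans hs]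
    nlinarith
  have h2 : (s : ℝ) ^ s ≤ 3 ^ s * s.factorial := by
    have h := Real.pow_div_factorial_le_exp (s : ℝ) (Nat.cast_nonneg s) s
    rw [div_le_iff₀ (by positivity)] at h
    refine h.trans (mul_le_mul_of_nonneg_right ?_ (by positivity))
    rw [← mul_one (s : ℝ), Real.exp_nat_mul]
    gcongr
    linarith [Real.exp_one_lt_d9]
  have h3 : (k : ℝ) ^ s * s.factorial ≤ s ^ s * k.descFactorial s := by exact_mod_cast h1
  have h4 : (0 : ℝ) < s.factorial := by positivity
  refine le_of_mul_le_mul_right (h3.trans ?_) h4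
  calc (s : ℝ) ^ s * k.descFactorial s ≤ 3 ^ s * s.factorial * k.descFactorial s := by gcongr
    _ = _ := by ring

lemma card_le_ell {F : Finset (Finset α)} {A : Finset α} (hA : A ∈ minimals F) :
    A.card ≤ ell F :=
  le_sup (f := Finset.card) hA

/-- If every injective colouring of `T` extends some rainbow partial colouring in `G`, then the
sizes of the members of `G` satisfy a LYM-type inequality. -/
lemma one_le_sum_inv_descFactorial {T : Finset α} (hT : T.card ≤ k)
    {G : Finset (Finset (α × Fin k))}
    (hG : ∀ S ∈ G, (S.image Prod.fst).card = S.card ∧ (S.image Prod.snd).card = S.card ∧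
      S.image Prod.fst ⊆ T)
    (hcover : ∀ c : T ↪ Fin k, ∃ S ∈ G, ∀ z ∈ S, ∃ h : z.1 ∈ T, c ⟨z.1, h⟩ = z.2) :
    1 ≤ ∑ S ∈ G, ((k.descFactorial S.card : ℝ))⁻¹ := by
  have hpos : (0 : ℝ) < k.descFactorial T.card := by
    exact_mod_cast Nat.descFactorial_pos.2 hT
  have hcount : k.descFactorial T.card ≤
      ∑ S ∈ G, (k - S.card).descFactorial (T.card - S.card) := by
    have h : (univ : Finset (T ↪ Fin k)).card ≤ (G.biUnion fun S =>
        univ.filter fun c : T ↪ Fin k => ∀ z ∈ S, ∃ h : z.1 ∈ T, c ⟨z.1, h⟩ = z.2).card := by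
      refine card_le_card fun c _ => ?_
      obtain ⟨S, hS, hc⟩ := hcover c
      exact mem_biUnion.2 ⟨S, hS, mem_filter.2 ⟨mem_univ _, hc⟩⟩
    rw [card_univ, Fintype.card_embedding_eq, Fintype.card_fin, Fintype.card_coe] at h
    refine h.trans (card_biUnion_le.trans (sum_le_sum fun S hS => ?_))
    obtain ⟨h1, h2, h3⟩ := hG S hS
    exact card_embedding_extending_le h1 h2 h3
  have hterm : ∀ S ∈ G, (((k - S.card).descFactorial (T.card - S.card) : ℕ) : ℝ) =
      k.descFactorial T.card * ((k.descFactorial S.card : ℝ))⁻¹ := fun S hS => by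
    obtain ⟨h1, -, h3⟩ := hG S hS
    have hle : S.card ≤ T.card := h1 ▸ card_le_card h3
    have : (k.descFactorial S.card : ℝ) ≠ 0 := by
      exact_mod_cast (Nat.descFactorial_pos.2 (hle.trans hT)).ne'
    rw [← Nat.descFactorial_mul_descFactorial hle]
    push_cast
    field_simp
  have h : (k.descFactorial T.card : ℝ) ≤
      ∑ S ∈ G, (((k - S.card).descFactorial (T.card - S.card) : ℕ) : ℝ) := by
    exact_mod_cast hcount
  rw [sum_congr rfl hterm, ← mul_sum] at h
  exact le_of_mul_le_mul_left ((mul_one _).trans_le h) hpos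

variable [Fintype α]

/-- The rainbow edges of the hypergraph of minimal members of `F`. -/
noncomputable def rainbowEdges (F : Finset (Finset α)) (k : ℕ) : Finset (Finset (α × Fin k)) :=
  univ.filter fun S => (S.image Prod.fst).card = S.card ∧
    (S.image Prod.snd).card = S.card ∧ S.image Prod.fst ∈ minimals F

lemma mem_rainbowEdges {F : Finset (Finset α)} {S : Finset (α × Fin k)} :
    S ∈ rainbowEdges F k ↔ (S.image Prod.fst).card = S.card ∧
      (S.image Prod.snd).card = S.card ∧ S.image Prod.fst ∈ minimals F := by
  simp [rainbowEdges]

lemma mem_rainbowFamily {F : Finset (Finset α)} {T : Finset (α × Fin k)} :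
    T ∈ rainbowFamily F k ↔ ∃ S ∈ rainbowEdges F k, S ⊆ T := by
  simp only [rainbowFamily, mem_filter, mem_univ, true_and, mem_rainbowEdges]
  exact exists_congr fun S => and_comm

lemma exists_rainbowEdge_of_embedding {F : Finset (Finset α)} {T : Finset α}
    (hT : T ∈ minimals F) (c : T ↪ Fin k) :
    ∃ E ∈ rainbowEdges F k, ∀ z ∈ E, ∃ h : z.1 ∈ T, c ⟨z.1, h⟩ = z.2 := by
  have hfst : Function.Injective fun x : T => (x.1, c x) := fun x y e =>
    Subtype.ext (Prod.mk.inj e).1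
  have hcard : (univ.image fun x : T => (x.1, c x)).card = T.card := by
    rw [card_image_of_injective _ hfst, card_univ, Fintype.card_coe]
  have hproj : (univ.image fun x : T => (x.1, c x)).image Prod.fst = T := by
    ext x
    simp
  refine ⟨univ.image fun x : T => (x.1, c x), mem_rainbowEdges.2 ⟨?_, ?_, ?_⟩, fun z hz => ?_⟩
  · rw [hproj, hcard]
  · rw [image_image, hcard, ← Fintype.card_coe T, ← card_univ]
    exact card_image_of_injective _ c.injective
  · rwa [hproj]
  · obtain ⟨x, -, rfl⟩ := mem_image.1 hz
    exact ⟨x.2, rfl⟩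

/-- A cover of the rainbow edges over `α × Fin k` projects to a fractional cover of `F`. -/
lemma weaklySmall_of_cover_rainbowEdges {F : Finset (Finset α)} (hk : ell F ≤ k) {q : ℝ}
    (hq : 0 ≤ q) {G : Finset (Finset (α × Fin k))}
    (hG : ∀ S ∈ rainbowEdges F k, ∃ T ∈ G, T ⊆ S)
    (hcost : ∑ T ∈ G, (3 * q / k) ^ T.card ≤ 1 / 2) : WeaklySmall q F := by
  set G' := G.filter fun S => (S.image Prod.fst).card = S.card ∧ (S.image Prod.snd).card = S.card
    with hG'
  have hsk : ∀ S : Finset (α × Fin k), (S.image Prod.snd).card = S.card → S.card ≤ k :=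
    fun S hS => by simpa [hS] using card_le_univ (S.image Prod.snd)
  refine ⟨fun A => ∑ S ∈ G', if S.image Prod.fst = A then ((k.descFactorial S.card : ℝ))⁻¹ else 0,
    fun A => sum_nonneg fun S _ => by split_ifs <;> positivity, fun T hT => ?_, ?_⟩
  · obtain ⟨T₀, hT₀, hT₀T⟩ := exists_minimals_subset hT
    have hcard := (card_le_ell hT₀).trans hk
    set G₀ := G'.filter fun S => S.image Prod.fst ⊆ T₀ with hG₀
    calc (1 : ℝ) ≤ ∑ S ∈ G₀, ((k.descFactorial S.card : ℝ))⁻¹ := by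
          refine one_le_sum_inv_descFactorial hcard (fun S hS => ?_) fun c => ?_
          · obtain ⟨hS, hST⟩ := mem_filter.1 hS
            obtain ⟨-, h1, h2⟩ := mem_filter.1 hS
            exact ⟨h1, h2, hST⟩
          · obtain ⟨E, hE, hEc⟩ := exists_rainbowEdge_of_embedding hT₀ c
            obtain ⟨S, hS, hSE⟩ := hG E hE
            obtain ⟨h1, h2, -⟩ := mem_rainbowEdges.1 hE
            refine ⟨S, mem_filter.2 ⟨mem_filter.2 ⟨hS, ?_, ?_⟩, ?_⟩, fun z hz => hEc z (hSE hz)⟩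
            · exact card_image_iff.2 ((card_image_iff.1 h1).mono (coe_subset.2 hSE))
            · exact card_image_iff.2 ((card_image_iff.1 h2).mono (coe_subset.2 hSE))
            · intro x hx
              obtain ⟨z, hz, rfl⟩ := mem_image.1 hx
              exact (hEc z (hSE hz)).1
      _ = ∑ S ∈ G', ∑ A ∈ T₀.powerset,
            if S.image Prod.fst = A then ((k.descFactorial S.card : ℝ))⁻¹ else 0 := by
          rw [hG₀, sum_filter]
          refine sum_congr rfl fun S _ => ?_
          rw [sum_ite_eq]
          simp only [mem_powerset]
      _ = ∑ A ∈ T₀.powerset, ∑ S ∈ G',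
            if S.image Prod.fst = A then ((k.descFactorial S.card : ℝ))⁻¹ else 0 := sum_comm
      _ ≤ _ := sum_le_sum_of_subset_of_nonneg (powerset_mono.2 hT₀T) fun A _ _ =>
          sum_nonneg fun S _ => by split_ifs <;> positivity
  · calc ∑ A : Finset α, (∑ S ∈ G', if S.image Prod.fst = A then
            ((k.descFactorial S.card : ℝ))⁻¹ else 0) * q ^ A.card
        = ∑ S ∈ G', ((k.descFactorial S.card : ℝ))⁻¹ * q ^ S.card := by
          simp only [sum_mul, ite_mul, zero_mul]
          rw [sum_comm]
          refine sum_congr rfl fun S hS => ?_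
          rw [sum_ite_eq, if_pos (mem_univ _), (mem_filter.1 hS).2.1]
      _ ≤ ∑ S ∈ G', (3 * q / k) ^ S.card := by
          refine sum_le_sum fun S hS => ?_
          have hs := hsk S (mem_filter.1 hS).2.2
          have h1 := pow_le_three_pow_mul_descFactorial hs
          have h2 : (0 : ℝ) < k.descFactorial S.card := by
            exact_mod_cast Nat.descFactorial_pos.2 hs
          have h3 : (0 : ℝ) < (k : ℝ) ^ S.card := by
            obtain h | h := Nat.eq_zero_or_pos k
            · rw [show S.card = 0 by omega, pow_zero]
              exact one_pos
            · positivity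
          rw [div_pow, mul_pow, inv_mul_eq_div, div_le_div_iff₀ h2 h3]
          nlinarith [mul_le_mul_of_nonneg_left h1 (pow_nonneg hq S.card)]
      _ ≤ ∑ S ∈ G, (3 * q / k) ^ S.card :=
          sum_le_sum_of_subset_of_nonneg (filter_subset _ _) fun S _ _ => by positivity
      _ ≤ 1 / 2 := hcost

/-- Adding several colours of one element to `W` hits a rainbow edge only if adding one of them
does. -/
lemma one_sub_missIndicator_union_le (F : Finset (Finset α)) (a : α) (C : Finset (Fin k))
    (W : Finset (α × Fin k)) :
    1 - missIndicator (rainbowEdges F k) (W ∪ ({a} : Finset α) ×ˢ C) ≤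
      1 - missIndicator (rainbowEdges F k) W + ∑ i ∈ C,
        (1 - missIndicator (rainbowEdges F k) (insert (a, i) W) -
          (1 - missIndicator (rainbowEdges F k) W)) := by
  set φ := missIndicator (rainbowEdges F k) with hφ
  have hterm : ∀ i ∈ C, 0 ≤ 1 - φ (insert (a, i) W) - (1 - φ W) := fun i _ => by
    linarith [missIndicator_antitone (rainbowEdges F k) (subset_insert (a, i) W)]
  have hsum := sum_nonneg hterm
  by_cases hW : ∃ S ∈ rainbowEdges F k, S ⊆ W
  · have h0 : φ W = 0 := if_pos hW
    linarith [missIndicator_nonneg (rainbowEdges F k) (W ∪ ({a} : Finset α) ×ˢ C)]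
  have h1 : φ W = 1 := if_neg hW
  by_cases hC : ∃ S ∈ rainbowEdges F k, S ⊆ W ∪ ({a} : Finset α) ×ˢ C
  · obtain ⟨S, hS, hSC⟩ := hC
    obtain ⟨z, hzS, hzW⟩ := not_subset.1 fun h => hW ⟨S, hS, h⟩
    have hcol : ∀ w ∈ S, w ∉ W → w.1 = a ∧ w.2 ∈ C := fun w hw hwW => by
      have := (mem_union.1 (hSC hw)).resolve_left hwW
      exact (mem_product.1 this).imp_left mem_singleton.1
    obtain ⟨hza, hzC⟩ := hcol z hzS hzW
    have hinj := card_image_iff.1 (mem_rainbowEdges.1 hS).1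
    have hz : z = (a, z.2) := Prod.ext hza rfl
    have h2 : φ (insert (a, z.2) W) = 0 := if_pos ⟨S, hS, fun w hw => by
      by_cases hwW : w ∈ W
      · exact mem_insert_of_mem hwW
      · rw [hinj hw hzS ((hcol w hw hwW).1.trans hza.symm), ← hz]
        exact mem_insert_self _ _⟩
    have h3 := single_le_sum hterm hzC
    linarith [missIndicator_nonneg (rainbowEdges F k) (W ∪ ({a} : Finset α) ×ˢ C)]
  · have h2 : φ (W ∪ ({a} : Finset α) ×ˢ C) = 1 := if_neg hC
    linarith

lemma muk_rainbowFamily_eq (F : Finset (Finset α)) (p : ℝ) :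
    muk p k (rainbowFamily F k) =
      coloredExp univ k p (fun S => 1 - missIndicator (rainbowEdges F k) S) := by
  rw [muk_eq_coloredExp]
  refine coloredExp_congr fun S _ => ?_
  simp only [mem_rainbowFamily, missIndicator]
  split_ifs <;> norm_num

/-- A fractional cover bounds the probability of the rainbow family. -/
lemma muk_rainbowFamily_le {F : Finset (Finset α)} (hF : Increasing F) (hk : k ≠ 0) {p : ℝ}
    (h0 : 0 ≤ p) (h1 : p ≤ 1) {g : Finset α → ℝ} (hg : ∀ S, 0 ≤ g S)
    (hgF : ∀ T ∈ F, 1 ≤ ∑ S ∈ T.powerset, g S) :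
    muk p k (rainbowFamily F k) ≤ ∑ A : Finset α, g A * p ^ A.card := by
  have hle : ∀ S ∈ partialColorings (univ : Finset α) k,
      (if S ∈ rainbowFamily F k then (1 : ℝ) else 0) ≤
        ∑ A : Finset α, g A * if A ⊆ S.image Prod.fst then 1 else 0 := by
    intro S _
    split_ifs with hS
    · obtain ⟨E, hE, hES⟩ := mem_rainbowFamily.1 hS
      have := hgF _ (hF _ (mem_of_mem_minimals (mem_rainbowEdges.1 hE).2.2) (S.image Prod.fst)
        (image_subset_image hES))
      refine this.trans_eq ?_
      rw [← sum_subset (subset_univ (S.image Prod.fst).powerset) fun A _ hA => ?_]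
      · exact sum_congr rfl fun A hA => by rw [if_pos (mem_powerset.1 hA), mul_one]
      · rw [if_neg fun h => hA (mem_powerset.2 h), mul_zero]
    · exact sum_nonneg fun A _ => mul_nonneg (hg A) (by split_ifs <;> norm_num)
  rw [muk_eq_coloredExp]
  refine (coloredExp_mono h0 h1 hle).trans_eq ?_
  rw [coloredExp_sum]
  exact sum_congr rfl fun A _ => by rw [coloredExp_subset_image hk p (subset_univ A)]

lemma le_of_weaklySmall {F : Finset (Finset α)} (hF : Increasing F) (hne : F.Nonempty)
    (hk : k ≠ 0) {p q : ℝ} (h0 : 0 < p) (h1 : p < 1)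
    (hp : muk p k (rainbowFamily F k) = 1 / 2) (hq : WeaklySmall q F) : q ≤ p := by
  obtain ⟨g, hg, hgF, hcost⟩ := hq
  by_contra! hpq
  have hmuk := muk_rainbowFamily_le hF hk h0.le h1.le hg hgF
  have hle : ∀ A ∈ (univ : Finset (Finset α)), g A * p ^ A.card ≤ g A * q ^ A.card :=
    fun A _ => mul_le_mul_of_nonneg_left (pow_le_pow_left₀ h0.le hpq.le _) (hg A)
  by_cases h : ∃ A : Finset α, A.Nonempty ∧ 0 < g A
  · obtain ⟨A, hA, hgA⟩ := h
    have := sum_lt_sum hle ⟨A, mem_univ A, mul_lt_mul_of_pos_left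
      (pow_lt_pow_left₀ hpq h0.le hA.card_ne_zero) hgA⟩
    linarith
  · push Not at h
    have hz : ∀ A : Finset α, A ≠ ∅ → g A = 0 := fun A hA =>
      (h A (nonempty_iff_ne_empty.2 hA)).antisymm (hg A)
    obtain ⟨T, hT⟩ := hne
    have hT' := hgF T hT
    rw [sum_eq_single ∅ (fun A _ hA => hz A hA) (fun h => absurd (empty_mem_powerset T) h)] at hT'
    rw [sum_eq_single ∅ (fun A _ hA => by rw [hz A hA, zero_mul])
      (fun h => absurd (mem_univ _) h)] at hcost
    simp only [card_empty, pow_zero, mul_one] at hcost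
    linarith

/-- If `F` is not weakly `q`-small, then the rainbow family is likely at density
`O(q log ℓ(F))`. -/
lemma half_lt_muk_rainbowFamily {F : Finset (Finset α)} (hk : ell F ≤ k) (hk0 : k ≠ 0)
    {p q : ℝ} (hq : 0 < q) (h1 : p < 1) {n : ℕ} (hn0 : n ≠ 0) (hn : ell F < 2 ^ n) (hqp : 96 * q * n ≤ p)
    (hF : ¬ WeaklySmall q F) : 1 / 2 < muk p k (rainbowFamily F k) := by
  have hk1 : (1 : ℝ) ≤ k := by exact_mod_cast Nat.one_le_iff_ne_zero.2 hk0
  have hp0 : 0 ≤ p := le_trans (by positivity) hqp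
  have hpk : p / k < 1 := (div_le_self hp0 hk1).trans_lt h1
  set r : ℝ := 3 * q / k with hr
  have hr0 : 0 ≤ r := by positivity
  have hrn : 32 * r * n ≤ p / k := by
    rw [hr, le_div_iff₀ (by linarith)]
    field_simp
    linarith
  have hn1 : (1 : ℝ) ≤ n := by exact_mod_cast Nat.one_le_iff_ne_zero.2 hn0
  have hr1 : 32 * r ≤ 1 := by nlinarith
  have hmiss := subsetExp_missIndicator_mul_le hr0 hr1 n (rainbowEdges F k)
    (fun S hS => by
      obtain ⟨h, -, hS⟩ := mem_rainbowEdges.1 hS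
      exact h ▸ (card_le_ell hS).trans_lt hn) (1 / 2) (fun G hG => by
      by_contra! h
      exact hF (weaklySmall_of_cover_rainbowEdges hk hq.le hG h.le))
  have hR : 1 - (1 - 32 * r) ^ n ≤ p / k := by
    have := one_add_mul_le_pow (show -2 ≤ -(32 * r) by linarith) n
    rw [← sub_eq_add_neg] at this
    linarith
  have hR0 : 0 ≤ 1 - (1 - 32 * r) ^ n :=
    sub_nonneg.2 (pow_le_one₀ (by linarith) (by linarith))
  have hanti := subsetExp_le_of_antitone (A := univ) hR0 hR hpk
    (missIndicator_antitone (rainbowEdges F k))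
  have hcol := subsetExp_le_coloredExp hk0 hp0 h1.le univ
    (fun S => 1 - missIndicator (rainbowEdges F k) S)
    (fun a _ C W => one_sub_missIndicator_union_le F a C W)
  have hlin : subsetExp (univ ×ˢ univ) (p / k)
      (fun S => 1 - missIndicator (rainbowEdges F k) S) =
        1 - subsetExp univ (p / k) (missIndicator (rainbowEdges F k)) := by
    rw [univ_product_univ]
    have := subsetExp_add univ (p / k) (fun S => 1 - missIndicator (rainbowEdges F k) S)
      (missIndicator (rainbowEdges F k))
    simp only [sub_add_cancel, subsetExp_const] at this
    linarith
  have hpow : (0 : ℝ) ≤ (1 / 8) ^ n := by positivity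
  rw [muk_rainbowFamily_eq]
  linarith

end Rainbow

/-- There is an absolute constant `K' > 0` such that for every finite `X`, every nontrivial
increasing family `F ⊆ 2^X` with `ℓ(F) ≥ 2`, every `k ≥ ℓ(F)`, and the `k`-color rainbow
threshold `p_c^k(F)` (the unique `p ∈ (0,1)` with `μ_p^k(F^rb) = 1/2`), one has
`q_f(F) ≤ p_c^k(F) ≤ K' q_f(F) log ℓ(F)`. -/
theorem rainbow_threshold_fractional :
    ∃ K' : ℝ, 0 < K' ∧
      ∀ (α : Type) [Fintype α] [DecidableEq α], ∀ F : Finset (Finset α),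
        Increasing F → F.Nonempty → F ≠ Finset.univ → 2 ≤ ell F →
        ∀ k : ℕ, ell F ≤ k →
        ∀ pck : ℝ, 0 < pck → pck < 1 → muk pck k (rainbowFamily F k) = 1 / 2 →
          qf F ≤ pck ∧ pck ≤ K' * qf F * Real.log (ell F) := by
  refine ⟨288, by norm_num, fun α _ _ F hF hne _ hl k hk p h0 h1 hp => ?_⟩
  have hk0 : k ≠ 0 := by omega
  have hle : ∀ q ∈ {q : ℝ | WeaklySmall q F}, q ≤ p := fun q hq =>
    le_of_weaklySmall hF hne hk0 h0 h1 hp hq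
  refine ⟨Real.sSup_le hle h0.le, ?_⟩
  set l := ell F with hl'
  have hlog2 : Real.log 2 ≤ Real.log l :=
    Real.log_le_log (by norm_num) (by exact_mod_cast hl)
  have h2 := Real.log_two_gt_d9
  have hlog : 0 < Real.log l := by linarith
  have hn : ((Nat.log 2 l + 1 : ℕ) : ℝ) ≤ 3 * Real.log l := by
    have h : ((2 ^ Nat.log 2 l : ℕ) : ℝ) ≤ l := by
      exact_mod_cast Nat.pow_log_le_self 2 (by omega)
    have h' := Real.log_le_log (by positivity) h
    rw [Nat.cast_pow, Real.log_pow, Nat.cast_ofNat] at h'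
    push_cast
    nlinarith
  by_contra! hlt
  set q := p / (288 * Real.log l) with hq
  have hq0 : 0 < q := by positivity
  have hqp : 288 * q * Real.log l = p := by rw [hq]; field_simp
  have hqf : qf F < q := by
    rw [hq, lt_div_iff₀ (by positivity)]
    linarith
  have hsmall : ¬ WeaklySmall q F := fun h => (le_csSup ⟨p, hle⟩ h).not_gt hqf
  have := half_lt_muk_rainbowFamily hk hk0 hq0 h1 (Nat.succ_ne_zero _)
    (Nat.lt_pow_succ_log_self one_lt_two l)
    (by nlinarith) hsmall
  linarith
end

section
/- For every finite set X, every nontrivial increasing family F ⊆ 2^X (i.e. ∅ ≠ F ≠ 2^X), and every integer k ≥ ℓ(F), one has p_c(F) ≤ p_c^k(F). -/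
open Finset
open scoped Classical

theorem empty_notMem_of_ne_univ {α : Type*} [Fintype α] {F : Finset (Finset α)}
    (hF : Increasing F) (hnu : F ≠ Finset.univ) : ∅ ∉ F := fun h =>
  hnu (Finset.eq_univ_iff_forall.2 fun B => hF ∅ h B (Finset.empty_subset B))

/-- Thinning a `p`-random set by `r` produces a `p * r`-random set. -/
theorem sum_superset_thinning {α : Type*} [Fintype α] (p r : ℝ) (T : Finset α) :
    ∑ S with T ⊆ S, (p ^ S.card * (1 - p) ^ (Fintype.card α - S.card)) *
      (r ^ T.card * (1 - r) ^ (S.card - T.card)) =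
    (p * r) ^ T.card * (1 - p * r) ^ (Fintype.card α - T.card) := by
  have h := Finset.sum_pow_mul_eq_add_pow (p * (1 - r)) (1 - p) Tᶜ
  rw [Finset.card_compl, show p * (1 - r) + (1 - p) = 1 - p * r by ring] at h
  rw [← h, Finset.mul_sum]
  refine Finset.sum_nbij' (fun S => S \ T) (fun U => U ∪ T) ?_ ?_ ?_ ?_ ?_
  · intro S _
    simp only [Finset.mem_powerset]
    intro x hx
    simp_all
  · intro U _
    simp
  · intro S hS
    exact Finset.sdiff_union_of_subset (Finset.mem_filter.1 hS).2
  · intro U hU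
    have hd : Disjoint U T :=
      Finset.subset_compl_iff_disjoint_right.1 (Finset.mem_powerset.1 hU)
    exact Finset.union_sdiff_cancel_right hd
  · intro S hS
    have hTS := (Finset.mem_filter.1 hS).2
    have hle := Finset.card_le_card hTS
    rw [Finset.card_sdiff_of_subset hTS]
    obtain ⟨m, hm⟩ := Nat.exists_eq_add_of_le hle
    rw [hm, Nat.add_sub_cancel_left, Nat.sub_sub, pow_add, mul_pow, mul_pow]
    ring

theorem mu_strictMono {α : Type*} [Fintype α] {F : Finset (Finset α)}
    (hF : Increasing F) (hne : F.Nonempty) (hnu : F ≠ Finset.univ)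
    {p q : ℝ} (hq0 : 0 < q) (hqp : q < p) (hp1 : p < 1) : mu q F < mu p F := by
  have hp0 : 0 < p := hq0.trans hqp
  obtain ⟨r, hr0, hr1, rfl⟩ : ∃ r, 0 < r ∧ r < 1 ∧ q = p * r :=
    ⟨q / p, div_pos hq0 hp0, (div_lt_one hp0).2 hqp, by field_simp⟩
  have hmem := empty_notMem_of_ne_univ hF hnu
  have hr1' : 0 < 1 - r := sub_pos.2 hr1
  have hp1' : 0 < 1 - p := sub_pos.2 hp1
  have key : mu (p * r) F = ∑ S ∈ F, (p ^ S.card * (1 - p) ^ (Fintype.card α - S.card)) *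
      ∑ T ∈ F with T ⊆ S, r ^ T.card * (1 - r) ^ (S.card - T.card) := by
    simp only [mu, ← sum_superset_thinning, Finset.mul_sum]
    refine Finset.sum_comm' fun T S => ?_
    simp only [Finset.mem_filter, Finset.mem_univ, true_and]
    exact ⟨fun h => ⟨⟨h.1, h.2⟩, hF T h.1 S h.2⟩, fun h => h.1⟩
  rw [key, mu]
  refine Finset.sum_lt_sum_of_nonempty hne fun S _ => ?_
  refine mul_lt_of_lt_one_right (by positivity) ?_
  have htot := Finset.sum_pow_mul_eq_add_pow r (1 - r) S
  rw [add_sub_cancel, one_pow] at htot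
  refine lt_of_lt_of_eq ?_ htot
  refine Finset.sum_lt_sum_of_subset (i := ∅) ?_ (Finset.empty_mem_powerset S) ?_ ?_ ?_
  · intro T hT
    exact Finset.mem_powerset.2 (Finset.mem_filter.1 hT).2
  · simp [hmem]
  · positivity
  · intro T _ _
    positivity

/-- A finite set has at most `k ^ |A|` colorings by `k` colors. -/
theorem card_filter_image_fst_eq_le {α : Type*} [Fintype α] [DecidableEq α] (k : ℕ)
    (A : Finset α) :
    (Finset.univ.filter fun T : Finset (α × Fin k) =>
      (T.image Prod.fst).card = T.card ∧ T.image Prod.fst = A).card ≤ k ^ A.card := by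
  have hsub : (Finset.univ.filter fun T : Finset (α × Fin k) =>
      (T.image Prod.fst).card = T.card ∧ T.image Prod.fst = A) ⊆
      (Finset.univ : Finset (A → Fin k)).image
        fun f => Finset.univ.image fun a : A => ((a : α), f a) := by
    intro T hT
    obtain ⟨hcard, rfl⟩ := (Finset.mem_filter.1 hT).2
    have hinj := Finset.card_image_iff.1 hcard
    have hex : ∀ a : T.image Prod.fst, ∃ c, ((a : α), c) ∈ T := by
      rintro ⟨a, ha⟩
      obtain ⟨⟨b, c⟩, hb, rfl⟩ := Finset.mem_image.1 ha
      exact ⟨c, hb⟩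
    choose f hf using hex
    refine Finset.mem_image.2 ⟨f, Finset.mem_univ _, ?_⟩
    ext ⟨b, c⟩
    simp only [Finset.mem_image, Finset.mem_univ, true_and]
    constructor
    · rintro ⟨a, ha⟩
      exact ha ▸ hf a
    · intro hb
      have ha : b ∈ T.image Prod.fst := Finset.mem_image.2 ⟨(b, c), hb, rfl⟩
      exact ⟨⟨b, ha⟩, hinj (hf ⟨b, ha⟩) hb rfl⟩
  refine (Finset.card_le_card hsub).trans (Finset.card_image_le.trans ?_)
  simp

theorem image_fst_mem_of_mem_rainbowFamily {α : Type*} [Fintype α] [DecidableEq α]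
    {F : Finset (Finset α)} (hF : Increasing F) {k : ℕ} {T : Finset (α × Fin k)}
    (hT : T ∈ rainbowFamily F k) : T.image Prod.fst ∈ F := by
  obtain ⟨S, hST, -, -, hS⟩ := (Finset.mem_filter.1 hT).2
  simp only [minimals, Finset.mem_filter] at hS
  exact hF _ hS.1 _ (Finset.image_subset_image hST)

theorem muk_rainbowFamily_le_mu {α : Type*} [Fintype α] [DecidableEq α]
    {F : Finset (Finset α)} (hF : Increasing F) (k : ℕ) {q : ℝ} (hq0 : 0 ≤ q) (hq1 : q ≤ 1) :
    muk q k (rainbowFamily F k) ≤ mu q F := by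
  have hq1' : 0 ≤ 1 - q := sub_nonneg.2 hq1
  rw [muk, mu, ← Finset.sum_filter]
  rw [← Finset.sum_fiberwise_of_maps_to (t := F) (g := fun T => T.image Prod.fst)
    fun T hT => image_fst_mem_of_mem_rainbowFamily hF (Finset.mem_filter.1 hT).1]
  refine Finset.sum_le_sum fun A _ => ?_
  have hterm : ∀ T ∈ ((rainbowFamily F k).filter fun T =>
      (T.image Prod.fst).card = T.card).filter (fun T => T.image Prod.fst = A),
      (q / (k : ℝ)) ^ T.card * (1 - q) ^ (Fintype.card α - T.card) =
        (q / (k : ℝ)) ^ A.card * (1 - q) ^ (Fintype.card α - A.card) := by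
    intro T hT
    simp only [Finset.mem_filter] at hT
    rw [← hT.1.2, hT.2]
  rw [Finset.sum_congr rfl hterm, Finset.sum_const, nsmul_eq_mul, ← mul_assoc]
  refine mul_le_mul_of_nonneg_right ?_ (by positivity)
  have hcard : (((rainbowFamily F k).filter fun T =>
      (T.image Prod.fst).card = T.card).filter (fun T => T.image Prod.fst = A)).card ≤
      k ^ A.card := by
    refine (Finset.card_le_card fun T hT => ?_).trans (card_filter_image_fst_eq_le k A)
    simp only [Finset.mem_filter, Finset.mem_univ, true_and] at hT ⊢
    exact ⟨hT.1.2, hT.2⟩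
  calc _ ≤ (k : ℝ) ^ A.card * (q / (k : ℝ)) ^ A.card := by
        refine mul_le_mul_of_nonneg_right ?_ (by positivity)
        exact_mod_cast hcard
    _ = (k * (q / k)) ^ A.card := (mul_pow _ _ _).symm
    _ ≤ q ^ A.card := by
        refine pow_le_pow_left₀ (by positivity) ?_ _
        rcases eq_or_ne (k : ℝ) 0 with hk | hk
        · simpa [hk] using hq0
        · exact (mul_div_cancel₀ q hk).le

/-- For every finite `X`, every nontrivial increasing family `F ⊆ 2^X`, and every
integer `k ≥ ℓ(F)`, the threshold `p_c(F)` (the unique `p ∈ (0,1)` with `μ_p(F) = 1/2`)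
is at most the `k`-color rainbow threshold `p_c^k(F)` (the unique `p ∈ (0,1)` with
`μ_p^k(F^rb) = 1/2`). -/
theorem threshold_le_rainbow_threshold {α : Type*} [Fintype α] [DecidableEq α]
    (F : Finset (Finset α)) (hF : Increasing F) (hne : F.Nonempty) (hnu : F ≠ Finset.univ)
    (k : ℕ) (hk : ell F ≤ k)
    (p q : ℝ) (hp0 : 0 < p) (hp1 : p < 1) (hq0 : 0 < q) (hq1 : q < 1)
    (hpc : mu p F = 1 / 2) (hqc : muk q k (rainbowFamily F k) = 1 / 2) :
    p ≤ q := by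
  by_contra! hqp
  have h := mu_strictMono hF hne hnu hq0 hqp hp1
  have h' := muk_rainbowFamily_le_mu hF k hq0.le hq1.le
  linarith
end
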